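/- For every unit vector θ ∈ C_X, the limit γ(θ) = lim_{k→∞} (1/k) log m(kθ), taken over positive integers k, exists and is a finite real number. -/

import Mathlib

open scoped BigOperators RealInnerProductSpace
open Filter Topology

noncomputable section

/-- `Euc s` is the Euclidean space `ℝ^s`. -/
abbrev Euc (s : ℕ) := EuclideanSpace ℝ (Fin s)

/-- The additive semigroup `X₁ℕ + ⋯ + X_mℕ` generated by the vectors `X j`. -/
def sgOf {s : ℕ} {ι : Type*} [Fintype ι] (X : ι → Euc s) : Set (Euc s) :=
  {z | ∃ u : ι → ℕ, ∑ j, (u j : ℝ) • X j = z}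

/-- The lattice `X₁ℤ + ⋯ + X_mℤ` generated by the vectors `X j`. -/
def latOf {s : ℕ} {ι : Type*} [Fintype ι] (X : ι → Euc s) : Set (Euc s) :=
  {z | ∃ u : ι → ℤ, ∑ j, (u j : ℝ) • X j = z}

/-- The convex cone `X₁ℝ⁺ + ⋯ + X_mℝ⁺` generated by the vectors `X j`. -/
def coneOf {s : ℕ} {ι : Type*} [Fintype ι] (X : ι → Euc s) : Set (Euc s) :=
  {x | ∃ c : ι → ℝ, (∀ j, 0 ≤ c j) ∧ ∑ j, c j • X j = x}

/-- The multiplicity of `z`: the number of finite words `i₁…i_n` with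
`X_{i₁} + ⋯ + X_{i_n} = z`. -/
def mult {s : ℕ} {ι : Type*} [Fintype ι] (X : ι → Euc s) (z : Euc s) : ℕ :=
  Set.ncard {w : List ι | (w.map X).sum = z}

/-- The multiplicity extended to the cone: the minimum of `mult X z` over points
`z` of the semigroup nearest to `x`. -/
def multC {s : ℕ} {ι : Type*} [Fintype ι] (X : ι → Euc s) (x : Euc s) : ℕ :=
  sInf {n | ∃ z ∈ sgOf X, dist x z = Metric.infDist x (sgOf X) ∧ mult X z = n}

/-- All the vectors `X j` have integer coordinates. -/
def IntegralVecs {s : ℕ} {ι : Type*} (X : ι → Euc s) : Prop :=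
  ∀ j i, ∃ n : ℤ, X j i = (n : ℝ)

/-- The entropy `h(p) = -∑ p_j log p_j` of a probability vector. -/
def entropy {m : ℕ} (p : Fin m → ℝ) : ℝ := -∑ j, p j * Real.log (p j)

/-- The `p`-th iteration of `X`: all sums `X_{ω₁} + ⋯ + X_{ω_p}` over words `ω`. -/
def iter {s m : ℕ} (X : Fin m → Euc s) (p : ℕ) : (Fin p → Fin m) → Euc s :=
  fun ω => ∑ i, X (ω i)


lemma aux_sum_count {s m : ℕ} (X : Fin m → Euc s) (w : List (Fin m)) :
    (w.map X).sum = ∑ j, (w.count j : ℝ) • X j := by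
  induction w with
  | nil => simp
  | cons a w ih =>
    simp only [List.map_cons, List.sum_cons, ih, List.count_cons, Nat.cast_add, add_smul,
      Finset.sum_add_distrib]
    rw [add_comm]
    congr 1
    simp

lemma aux_exists_word {m : ℕ} (u : Fin m → ℕ) : ∃ w : List (Fin m), ∀ j, w.count j = u j := by
  refine ⟨(∑ j, u j • ({j} : Multiset (Fin m))).toList, fun j => ?_⟩
  rw [← Multiset.coe_count, Multiset.coe_toList, Multiset.count_sum']
  simp [Multiset.count_singleton]

lemma aux_subperm {m : ℕ} {l w : List (Fin m)} (h : ∀ j, l.count j ≤ w.count j) :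
    l.Subperm w := by
  rw [← Multiset.coe_le, Multiset.le_iff_count]
  simpa using h

/-- linear bound on the length of words -/
lemma aux_length {s m : ℕ} (X : Fin m → Euc s) (α : Euc s) (hα : ∀ j, 0 < ⟪X j, α⟫) :
    ∃ B : ℝ, 0 ≤ B ∧ ∀ w : List (Fin m), (w.length : ℝ) ≤ B * ‖(w.map X).sum‖ := by
  obtain ⟨δ, hδ, h⟩ : ∃ δ : ℝ, 0 < δ ∧ ∀ j, δ ≤ ⟪X j, α⟫ := by
    rcases isEmpty_or_nonempty (Fin m) with h | h
    · exact ⟨1, one_pos, fun j => h.elim j⟩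
    · obtain ⟨j, hj⟩ := Finite.exists_min (fun j => ⟪X j, α⟫)
      exact ⟨_, hα j, hj⟩
  refine ⟨‖α‖ / δ, by positivity, fun w => ?_⟩
  have h1 : (w.length : ℝ) * δ ≤ ⟪(w.map X).sum, α⟫ := by
    induction w with
    | nil => simp
    | cons a w ih =>
      simp only [List.length_cons, List.map_cons, List.sum_cons, inner_add_left]
      push_cast
      linarith [h a]
  have h2 := real_inner_le_norm (w.map X).sum α
  rw [div_mul_eq_mul_div, le_div_iff₀ hδ]
  linarith

lemma aux_finite {s m : ℕ} (X : Fin m → Euc s) (α : Euc s) (hα : ∀ j, 0 < ⟪X j, α⟫)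
    (z : Euc s) : {w : List (Fin m) | (w.map X).sum = z}.Finite := by
  obtain ⟨B, hB, h⟩ := aux_length X α hα
  refine (List.finite_length_le (Fin m) ⌊B * ‖z‖⌋₊).subset ?_
  intro w hw
  simp only [Set.mem_ofPred_eq] at hw ⊢
  apply Nat.le_floor
  rw [← hw]; exact h w

lemma aux_upper {s m : ℕ} (X : Fin m → Euc s) (z : Euc s) (L : ℕ)
    (hL : ∀ w : List (Fin m), (w.map X).sum = z → w.length ≤ L) :
    mult X z ≤ (m + 1) ^ L := by
  have : mult X z ≤ (Set.univ : Set (Fin L → Option (Fin m))).ncard := by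
    refine Set.ncard_le_ncard_of_injOn (fun w i => w[(i : ℕ)]?) (fun _ _ => Set.mem_univ _) ?_
      Set.finite_univ
    intro w hw w' hw' h
    apply List.ext_getElem?
    intro i
    by_cases hi : i < L
    · exact congrFun h ⟨i, hi⟩
    · have h1 := hL w hw
      have h2 := hL w' hw'
      rw [List.getElem?_eq_none (by omega), List.getElem?_eq_none (by omega)]
  simpa [Set.ncard_univ] using this

lemma aux_supermul {s m : ℕ} (X : Fin m → Euc s) (α : Euc s) (hα : ∀ j, 0 < ⟪X j, α⟫)
    (y z : Euc s) : mult X y * mult X z ≤ mult X (y + z) := by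
  obtain ⟨B, hB, hlen⟩ := aux_length X α hα
  unfold mult
  rw [← Set.ncard_prod]
  refine Set.ncard_le_ncard_of_injOn (fun p => p.1 ++ p.2) ?_ ?_ (aux_finite X α hα _)
  · rintro ⟨a, b⟩ ⟨ha, hb⟩
    simp only [Set.mem_ofPred_eq] at ha hb ⊢
    simp [ha, hb]
  · rintro ⟨a, b⟩ ⟨ha, hb⟩ ⟨a', b'⟩ ⟨ha', hb'⟩ h
    simp only [Set.mem_ofPred_eq] at ha hb ha' hb' h
    have key : ∀ c : List (Fin m), (c.map X).sum = 0 → c = [] := by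
      intro c hc
      have := hlen c
      rw [hc, norm_zero, mul_zero] at this
      have h0 : c.length = 0 := by exact_mod_cast le_antisymm this (by positivity)
      exact List.eq_nil_of_length_eq_zero h0
    rcases List.append_eq_append_iff.1 h with ⟨c, h1, h2⟩ | ⟨c, h1, h2⟩
    · have : c = [] := key c (by
        subst h1
        simp only [List.map_append, List.sum_append, ha] at ha'
        simpa using ha')
      subst this; simp_all
    · have : c = [] := key c (by
        subst h1
        simp only [List.map_append, List.sum_append, ha'] at ha
        simpa using ha)
      subst this; simp_all

lemma aux_pos {s m : ℕ} (X : Fin m → Euc s) (α : Euc s) (hα : ∀ j, 0 < ⟪X j, α⟫)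
    (z : Euc s) (hz : z ∈ sgOf X) : 1 ≤ mult X z := by
  obtain ⟨u, hu⟩ := hz
  obtain ⟨w, hw⟩ := aux_exists_word u
  refine (Set.ncard_pos (aux_finite X α hα z)).2 ⟨w, ?_⟩
  simp [aux_sum_count, hw, hu]

lemma aux_count {s m : ℕ} (X : Fin m → Euc s) (α : Euc s) (hα : ∀ j, 0 < ⟪X j, α⟫)
    (L : ℕ) (l : List (Fin m)) : ∀ z : Euc s,
    {w : List (Fin m) | (w.map X).sum = z ∧ w.length ≤ L ∧ l.Subperm w}.ncard
      ≤ (L + 1) ^ l.length * mult X (z - (l.map X).sum) := by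
  induction l with
  | nil =>
    intro z
    simp only [List.length_nil, pow_zero, one_mul, List.map_nil, List.sum_nil, sub_zero]
    exact Set.ncard_le_ncard (fun w hw => hw.1) (aux_finite X α hα z)
  | cons a l ih =>
    intro z
    have h1 := ih (z - X a)
    have h2 : {w : List (Fin m) | (w.map X).sum = z ∧ w.length ≤ L ∧ (a :: l).Subperm w}.ncard ≤
        ({w : List (Fin m) | (w.map X).sum = z - X a ∧ w.length ≤ L ∧ l.Subperm w} ×ˢ
          (Finset.range (L + 1) : Set ℕ)).ncard := by
      refine Set.ncard_le_ncard_of_injOn (fun w => (w.erase a, w.idxOf a)) ?_ ?_ ?_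
      · rintro w ⟨hw, hwL, hs⟩
        have hmem : a ∈ w := hs.subset (by simp)
        refine ⟨⟨?_, ?_, ?_⟩, ?_⟩
        · have := ((List.perm_cons_erase hmem).map X).sum_eq
          simp only [List.map_cons, List.sum_cons] at this
          rw [← hw, this]; simp
        · exact (List.erase_sublist.length_le).trans hwL
        · simpa using hs.erase a
        · simp only [Finset.coe_range, Set.mem_Iio]
          have := List.idxOf_le_length (a := a) (l := w)
          omega
      · rintro w ⟨hw, hwL, hs⟩ w' ⟨hw', hwL', hs'⟩ h
        have hmem : a ∈ w := hs.subset (by simp)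
        have hmem' : a ∈ w' := hs'.subset (by simp)
        simp only [Prod.mk.injEq] at h
        have hrec : ∀ v : List (Fin m), a ∈ v → (v.erase a).insertIdx (v.idxOf a) a = v := by
          intro v hv
          rw [List.erase_eq_eraseIdx_of_idxOf rfl]
          have hlt := List.idxOf_lt_length_of_mem hv
          have := List.insertIdx_eraseIdx_getElem hlt
          simpa using this
        rw [← hrec w hmem, ← hrec w' hmem', h.1, h.2]
      · exact ((aux_finite X α hα _).subset (fun w hw => hw.1)).prod (Finset.finite_toSet _)
    rw [Set.ncard_prod, Set.ncard_coe_finset, Finset.card_range] at h2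
    simp only [List.length_cons, List.map_cons, List.sum_cons]
    rw [← sub_sub, pow_succ]
    calc _ ≤ _ := h2
      _ ≤ _ := Nat.mul_le_mul_right _ h1
      _ = _ := by ring

lemma aux_intfin (s : ℕ) (R : ℝ) :
    {z : Euc s | (∀ i, ∃ n : ℤ, z i = n) ∧ ‖z‖ ≤ R}.Finite := by
  refine ((Set.finite_Icc (fun _ : Fin s => -⌈R⌉) (fun _ => ⌈R⌉)).image
    (fun n => (WithLp.toLp 2 (fun i => (n i : ℝ)) : Euc s))).subset ?_
  rintro z ⟨hz, hR⟩
  choose n hn using hz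
  refine ⟨n, ?_, ?_⟩
  · have : ∀ i, |n i| ≤ ⌈R⌉ := by
      intro i
      have h1 : ‖z i‖ ≤ ‖z‖ := PiLp.norm_apply_le z i
      rw [hn i, Real.norm_eq_abs] at h1
      have h2 : ((|n i| : ℤ) : ℝ) ≤ (⌈R⌉ : ℝ) := by
        push_cast
        exact (h1.trans hR).trans (Int.le_ceil R)
      exact_mod_cast h2
    exact ⟨fun i => (abs_le.1 (this i)).1, fun i => (abs_le.1 (this i)).2⟩
  · ext i; simp [hn]

/-- Dickson for a fixed difference -/
lemma aux_dickson_one {s m : ℕ} (X : Fin m → Euc s) (d : Euc s) :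
    ∃ F : Finset (Fin m → ℕ), ∀ u v : Fin m → ℕ,
      ∑ j, (u j : ℝ) • X j - ∑ j, (v j : ℝ) • X j = d →
      ∃ u0 ∈ F, u0 ≤ u ∧
        (∑ j, (v j : ℝ) • X j) - (∑ j, (u j : ℝ) • X j - ∑ j, (u0 j : ℝ) • X j) ∈ sgOf X := by
  have : WellQuasiOrderedLE (Fin m → ℕ) := inferInstance
  let P : (Fin m → ℕ) × (Fin m → ℕ) → Prop := fun p =>
    ∑ j, (p.1 j : ℝ) • X j - ∑ j, (p.2 j : ℝ) • X j = d
  have hfin : {p | Minimal P p}.Finite :=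
    WellQuasiOrderedLE.finite_of_isAntichain (setOfPred_minimal_antichain P)
  classical
  refine ⟨hfin.toFinset.image Prod.fst, fun u v h => ?_⟩
  obtain ⟨⟨u0, v0⟩, hle, hmin⟩ := exists_minimal_le_of_wellFoundedLT P (u, v) h
  refine ⟨u0, ?_, hle.1, v0, ?_⟩
  · simp only [Finset.mem_image, Set.Finite.mem_toFinset, Set.mem_ofPred_eq]
    exact ⟨_, hmin, rfl⟩
  · have h0 : ∑ j, (u0 j : ℝ) • X j - ∑ j, (v0 j : ℝ) • X j = d := hmin.prop
    rw [sub_sub_eq_add_sub, ← sub_eq_zero]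
    have := h.trans h0.symm
    rw [← sub_eq_zero] at this
    rw [← this]; abel

lemma aux_int {s m : ℕ} (X : Fin m → Euc s) (hint : IntegralVecs X) (z : Euc s)
    (hz : z ∈ sgOf X) : ∀ i, ∃ n : ℤ, z i = n := by
  obtain ⟨u, rfl⟩ := hz
  choose N hN using hint
  intro i
  refine ⟨∑ j, u j * N j i, ?_⟩
  simp [hN]

lemma aux_dickson {s m : ℕ} (X : Fin m → Euc s) (hint : IntegralVecs X) (R : ℝ) :
    ∃ F : Finset (Fin m → ℕ), ∀ u : Fin m → ℕ, ∀ z' ∈ sgOf X,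
      ‖∑ j, (u j : ℝ) • X j - z'‖ ≤ R →
      ∃ u0 ∈ F, u0 ≤ u ∧
        z' - (∑ j, (u j : ℝ) • X j - ∑ j, (u0 j : ℝ) • X j) ∈ sgOf X := by
  classical
  choose F hF using aux_dickson_one X
  refine ⟨(aux_intfin s R).toFinset.biUnion F, ?_⟩
  rintro u z' hz' hR
  obtain ⟨v, rfl⟩ := id hz'
  obtain ⟨u0, h1, h2⟩ := hF _ u v rfl
  refine ⟨u0, ?_, h2⟩
  rw [Finset.mem_biUnion]
  refine ⟨_, ?_, h1⟩
  rw [Set.Finite.mem_toFinset]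
  refine ⟨fun i => ?_, hR⟩
  obtain ⟨a, ha⟩ := aux_int X hint _ ⟨u, rfl⟩ i
  obtain ⟨b, hb⟩ := aux_int X hint _ hz' i
  refine ⟨a - b, ?_⟩
  rw [PiLp.sub_apply, ha, hb]; simp

/-- nearby points have polynomially comparable multiplicity -/
lemma aux_compare {s m : ℕ} (X : Fin m → Euc s) (hint : IntegralVecs X)
    (α : Euc s) (hα : ∀ j, 0 < ⟪X j, α⟫) (R : ℝ) :
    ∃ A K : ℕ, ∀ z ∈ sgOf X, ∀ z' ∈ sgOf X, ‖z - z'‖ ≤ R → ∀ L : ℕ,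
      (∀ w : List (Fin m), (w.map X).sum = z → w.length ≤ L) →
      mult X z ≤ A * (L + 1) ^ K * mult X z' := by
  classical
  obtain ⟨F, hF⟩ := aux_dickson X hint R
  choose wd hwd using @aux_exists_word m
  have hwds : ∀ u : Fin m → ℕ, ((wd u).map X).sum = ∑ j, (u j : ℝ) • X j := by
    intro u; simp [aux_sum_count, hwd]
  refine ⟨F.card, F.sup (fun u => (wd u).length), fun z hz z' hz' hzz L hL => ?_⟩
  let G := F.filter (fun u0 => z' - (z - ∑ j, (u0 j : ℝ) • X j) ∈ sgOf X)
  let S : (Fin m → ℕ) → Set (List (Fin m)) := fun u0 =>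
    {w | (w.map X).sum = z ∧ w.length ≤ L ∧ (wd u0).Subperm w}
  have hsub : {w : List (Fin m) | (w.map X).sum = z} ⊆ ⋃ u0 ∈ G, S u0 := by
    intro w hw
    simp only [Set.mem_ofPred_eq] at hw
    have hw2 := hw
    rw [aux_sum_count] at hw2
    obtain ⟨u0, h1, h2, h3⟩ := hF (fun j => w.count j) z' hz' (by rw [hw2]; exact hzz)
    rw [hw2] at h3
    simp only [Set.mem_iUnion]
    refine ⟨u0, Finset.mem_filter.2 ⟨h1, h3⟩, hw, hL w hw, aux_subperm fun j => ?_⟩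
    rw [hwd]; exact h2 j
  have hS : ∀ u0 ∈ G, (S u0).ncard ≤ (L + 1) ^ (F.sup fun u => (wd u).length) * mult X z' := by
    intro u0 hu0
    obtain ⟨hu1, hu2⟩ := Finset.mem_filter.1 hu0
    refine (aux_count X α hα L (wd u0) z).trans ?_
    rw [hwds]
    refine Nat.mul_le_mul ?_ ?_
    · exact Nat.pow_le_pow_right (by omega) (Finset.le_sup (f := fun u => (wd u).length) hu1)
    · have h1 := aux_supermul X α hα (z - ∑ j, (u0 j : ℝ) • X j)
        (z' - (z - ∑ j, (u0 j : ℝ) • X j))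
      rw [add_sub_cancel] at h1
      exact (Nat.le_mul_of_pos_right _ (aux_pos X α hα _ hu2)).trans h1
  have hSf : (⋃ u0 ∈ G, S u0).Finite :=
    (aux_finite X α hα z).subset (by
      intro w hw
      simp only [Set.mem_iUnion] at hw
      obtain ⟨u0, _, h⟩ := hw
      exact h.1)
  calc mult X z ≤ (⋃ u0 ∈ G, S u0).ncard := Set.ncard_le_ncard hsub hSf
    _ ≤ ∑ u0 ∈ G, (S u0).ncard := Finset.set_ncard_biUnion_le G S
    _ ≤ ∑ u0 ∈ G, ((L + 1) ^ (F.sup fun u => (wd u).length) * mult X z') :=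
      Finset.sum_le_sum hS
    _ = G.card * ((L + 1) ^ (F.sup fun u => (wd u).length) * mult X z') := by simp
    _ ≤ F.card * ((L + 1) ^ (F.sup fun u => (wd u).length) * mult X z') :=
      Nat.mul_le_mul_right _ (Finset.card_filter_le _ _)
    _ = _ := by ring

/-- the multiplicity on the cone is attained -/
lemma aux_multC {s m : ℕ} (X : Fin m → Euc s) (hint : IntegralVecs X) (x : Euc s) :
    ∃ z ∈ sgOf X, dist x z = Metric.infDist x (sgOf X) ∧ mult X z = multC X x := by
  have hne : {n | ∃ z ∈ sgOf X, dist x z = Metric.infDist x (sgOf X) ∧ mult X z = n}.Nonempty := by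
    have h0 : (0 : Euc s) ∈ sgOf X := ⟨0, by simp⟩
    have hfin : {z | z ∈ sgOf X ∧ dist x z ≤ dist x 0}.Finite := by
      refine (aux_intfin s (2 * ‖x‖)).subset ?_
      rintro z ⟨hz, hd⟩
      refine ⟨aux_int X hint z hz, ?_⟩
      rw [dist_zero_right, dist_eq_norm] at hd
      have := norm_sub_le x (x - z)
      simp only [sub_sub_cancel] at this
      linarith
    obtain ⟨z, ⟨hz, hz0⟩, hmin⟩ := hfin.exists_minimalFor (fun z => dist x z) _ ⟨0, h0, le_rfl⟩
    refine ⟨_, z, hz, ?_, rfl⟩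
    refine le_antisymm ?_ (Metric.infDist_le_dist_of_mem hz)
    refine (Metric.le_infDist ⟨0, h0⟩).2 ?_
    intro y hy
    by_contra hlt
    push Not at hlt
    have := hmin ⟨hy, hlt.le.trans hz0⟩ hlt.le
    exact absurd this (not_le.2 hlt)
  exact Nat.sInf_mem hne

set_option maxHeartbeats 1600000 in
/-- For every unit vector `θ ∈ C_X`, the limit
`γ(θ) = lim_{k→∞} (1/k) log m(kθ)` exists and is a finite real number. -/
theorem stmt7 {s m : ℕ} (hs : 1 ≤ s) (hm : 2 ≤ m) (X : Fin m → Euc s)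
    (hint : IntegralVecs X)
    (hspan : Submodule.span ℝ (Set.range X) = ⊤)
    (α : Euc s) (hα : ∀ j, 0 < ⟪X j, α⟫)
    (θ : Euc s) (hθc : θ ∈ coneOf X) (hθ : ‖θ‖ = 1) :
    ∃ γ : ℝ, Filter.Tendsto
      (fun k : ℕ => Real.log (multC X ((k : ℝ) • θ)) / k)
      Filter.atTop (nhds γ) := by
  obtain ⟨c, hc, hcθ⟩ := hθc
  obtain ⟨B, hB, hlen⟩ := aux_length X α hα
  obtain ⟨R, hR⟩ : ∃ R : ℝ, R = ∑ j, ‖X j‖ := ⟨_, rfl⟩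
  obtain ⟨D, hD⟩ : ∃ D : ℝ, D = ∑ j, c j * ‖X j‖ := ⟨_, rfl⟩
  have hR0 : 0 ≤ R := hR ▸ Finset.sum_nonneg fun j _ => norm_nonneg _
  have hD0 : 0 ≤ D := hD ▸ Finset.sum_nonneg fun j _ => mul_nonneg (hc j) (norm_nonneg _)
  let y : ℕ → Euc s := fun k => ∑ j, ((⌊(k : ℝ) * c j⌋₊ : ℕ) : ℝ) • X j
  have hkc : ∀ (k : ℕ) j, 0 ≤ (k : ℝ) * c j := fun k j => mul_nonneg (Nat.cast_nonneg _) (hc j)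
  have hyJ : ∀ k, y k ∈ sgOf X := fun k => ⟨_, rfl⟩
  have hyn : ∀ k, ‖y k‖ ≤ D * k := by
    intro k
    refine (norm_sum_le _ _).trans ?_
    rw [hD, Finset.sum_mul]
    refine Finset.sum_le_sum fun j _ => ?_
    rw [norm_smul, Real.norm_of_nonneg (Nat.cast_nonneg _)]
    have := mul_le_mul_of_nonneg_right (Nat.floor_le (hkc k j)) (norm_nonneg (X j))
    linarith
  have hyd : ∀ k : ℕ, ‖(k : ℝ) • θ - y k‖ ≤ R := by
    intro k
    rw [hR, ← hcθ, Finset.smul_sum, ← Finset.sum_sub_distrib]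
    refine (norm_sum_le _ _).trans (Finset.sum_le_sum fun j _ => ?_)
    rw [smul_smul, ← sub_smul, norm_smul]
    have h1 := Nat.floor_le (hkc k j)
    have h2 := Nat.lt_floor_add_one ((k : ℝ) * c j)
    have h3 : ‖(k : ℝ) * c j - (⌊(k : ℝ) * c j⌋₊ : ℕ)‖ ≤ 1 := by
      rw [Real.norm_eq_abs, abs_le]; constructor <;> linarith
    exact mul_le_of_le_one_left (norm_nonneg _) h3
  choose z hzJ hzd hzm using fun k : ℕ => aux_multC X hint ((k : ℝ) • θ)
  have hzy : ∀ k, ‖z k - y k‖ ≤ 2 * R := by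
    intro k
    have h1 : ‖(k : ℝ) • θ - z k‖ ≤ R := by
      rw [← dist_eq_norm, hzd]
      refine (Metric.infDist_le_dist_of_mem (hyJ k)).trans ?_
      rw [dist_eq_norm]; exact hyd k
    have h2 := norm_sub_le ((k : ℝ) • θ - y k) ((k : ℝ) • θ - z k)
    rw [sub_sub_sub_cancel_left] at h2
    linarith [hyd k]
  have hmpos : ∀ w ∈ sgOf X, (1 : ℝ) ≤ mult X w := fun w hw => by
    exact_mod_cast aux_pos X α hα w hw
  let b : ℕ → ℝ := fun k => Real.log (mult X (y k))
  -- Fekete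
  have hsub : Subadditive (fun k => - b k) := by
    intro k l
    have he : y (k + l) - (y k + y l) ∈ sgOf X := by
      have hfl : ∀ j, ⌊(k : ℝ) * c j⌋₊ + ⌊(l : ℝ) * c j⌋₊ ≤ ⌊((k + l : ℕ) : ℝ) * c j⌋₊ := by
        intro j
        apply Nat.le_floor
        push_cast
        linarith [Nat.floor_le (hkc k j), Nat.floor_le (hkc l j)]
      refine ⟨fun j => ⌊((k + l : ℕ) : ℝ) * c j⌋₊ - (⌊(k : ℝ) * c j⌋₊ + ⌊(l : ℝ) * c j⌋₊), ?_⟩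
      simp only [y]
      rw [← Finset.sum_add_distrib, ← Finset.sum_sub_distrib]
      refine Finset.sum_congr rfl fun j _ => ?_
      rw [Nat.cast_sub (hfl j), ← add_smul, ← sub_smul, Nat.cast_add ⌊(k : ℝ) * c j⌋₊]
    have h1 := aux_supermul X α hα (y k) (y l)
    have h2 := aux_supermul X α hα (y k + y l) (y (k + l) - (y k + y l))
    rw [add_sub_cancel] at h2
    have h3 := aux_pos X α hα _ he
    have h4 : mult X (y k) * mult X (y l) ≤ mult X (y (k + l)) :=
      h1.trans ((Nat.le_mul_of_pos_right _ h3).trans h2)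
    have h5 : (mult X (y k) : ℝ) * mult X (y l) ≤ mult X (y (k + l)) := by exact_mod_cast h4
    have hk := hmpos _ (hyJ k)
    have hl := hmpos _ (hyJ l)
    have h6 := Real.log_le_log (by positivity) h5
    rw [Real.log_mul (by positivity) (by positivity)] at h6
    simp only [b]
    linarith
  have hlog : 0 ≤ Real.log ((m : ℝ) + 1) := Real.log_nonneg (by linarith [Nat.cast_nonneg (α := ℝ) m])
  have hbdd : BddBelow (Set.range fun n : ℕ => (fun k => - b k) n / (n : ℝ)) := by
    refine ⟨-(B * D * Real.log ((m : ℝ) + 1)), ?_⟩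
    rintro _ ⟨n, rfl⟩
    simp only
    rcases Nat.eq_zero_or_pos n with rfl | hn
    · simp only [Nat.cast_zero, div_zero, Left.neg_nonpos_iff]; positivity
    · have hn' : (0 : ℝ) < n := by exact_mod_cast hn
      rw [le_div_iff₀ hn']
      have h1 := aux_upper X (y n) ⌊B * (D * n)⌋₊ (fun w hw => by
        apply Nat.le_floor
        refine (hlen w).trans ?_
        rw [hw]; exact mul_le_mul_of_nonneg_left (hyn n) hB)
      have h2 : (mult X (y n) : ℝ) ≤ ((m : ℝ) + 1) ^ ⌊B * (D * n)⌋₊ := by exact_mod_cast h1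
      have h3 := Real.log_le_log (by linarith [hmpos _ (hyJ n)]) h2
      rw [Real.log_pow] at h3
      have h4 := mul_le_mul_of_nonneg_right
        (Nat.floor_le (show 0 ≤ B * (D * n) by positivity)) hlog
      simp only [b]
      nlinarith
  have hlim := hsub.tendsto_lim hbdd
  -- comparison
  obtain ⟨A, K, hAK⟩ := aux_compare X hint α hα (2 * R)
  obtain ⟨E, hEd⟩ : ∃ E : ℝ, E = B * D + 2 * (B * R) + 2 := ⟨_, rfl⟩
  have hE : 0 < E := by
    have h1 := mul_nonneg hB hD0
    have h2 := mul_nonneg hB hR0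
    linarith
  have hcmp : ∀ k : ℕ, |Real.log (mult X (z k)) - b k| ≤
      Real.log A + K * (Real.log E + Real.log ((k : ℝ) + 1)) := by
    intro k
    obtain ⟨L, hLd⟩ : ∃ L : ℕ, L = ⌈B * (D * k + 2 * R)⌉₊ := ⟨_, rfl⟩
    have hL : (L : ℝ) + 1 ≤ E * ((k : ℝ) + 1) := by
      have h1 := Nat.ceil_lt_add_one (show 0 ≤ B * (D * k + 2 * R) by positivity)
      have hk : (0 : ℝ) ≤ k := Nat.cast_nonneg k
      have h2 : 0 ≤ B * D := by positivity
      have h3 : 0 ≤ B * R * k := by positivity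
      rw [← hLd] at h1
      rw [hEd]
      nlinarith
    have hLen : ∀ v : Euc s, ‖v‖ ≤ D * k + 2 * R →
        ∀ w : List (Fin m), (w.map X).sum = v → w.length ≤ L := by
      intro v hv w hw
      have : (w.length : ℝ) ≤ L := by
        rw [hLd]
        refine ((hlen w).trans ?_).trans (Nat.le_ceil _)
        rw [hw]; exact mul_le_mul_of_nonneg_left hv hB
      exact_mod_cast this
    have gen : ∀ v ∈ sgOf X, ∀ v' ∈ sgOf X, ‖v - v'‖ ≤ 2 * R → ‖v‖ ≤ D * k + 2 * R →
        Real.log (mult X v) - Real.log (mult X v') ≤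
          Real.log A + K * (Real.log E + Real.log ((k : ℝ) + 1)) := by
      intro v hv v' hv' hd hn
      have h1 := hAK v hv v' hv' hd L (hLen v hn)
      have h2 : (mult X v : ℝ) ≤ A * ((L : ℝ) + 1) ^ K * mult X v' := by exact_mod_cast h1
      have hv1 := hmpos v hv
      have hv1' := hmpos v' hv'
      have hA : (A : ℝ) ≠ 0 := by
        rintro h0
        rw [h0] at h2
        simp only [zero_mul] at h2
        linarith
      have h3 := Real.log_le_log (by linarith) h2
      rw [Real.log_mul (by positivity) (by positivity), Real.log_mul hA (by positivity),
        Real.log_pow] at h3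
      have h4 := Real.log_le_log (by positivity) hL
      rw [Real.log_mul hE.ne' (by positivity)] at h4
      have h5 := mul_le_mul_of_nonneg_left h4 (Nat.cast_nonneg (α := ℝ) K)
      linarith
    have hy1 := hyn k
    have hz1 := hzy k
    rw [abs_le]
    constructor
    · have := gen (y k) (hyJ k) (z k) (hzJ k) (by rw [norm_sub_rev]; exact hz1) (by linarith)
      simp only [b]; linarith
    · refine gen (z k) (hzJ k) (y k) (hyJ k) hz1 ?_
      have := norm_add_le (z k - y k) (y k)
      rw [sub_add_cancel] at this
      linarith
  have hdiff : Tendsto (fun k : ℕ => (Real.log (mult X (z k)) - b k) / k) atTop (𝓝 0) := by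
    have hl1 : Tendsto (fun k : ℕ => Real.log ((k : ℝ) + 1) / k) atTop (𝓝 0) := by
      have h1 := Real.tendsto_pow_log_div_mul_add_atTop 1 (-1) 1 one_ne_zero
      have h2 : Tendsto (fun k : ℕ => (k : ℝ) + 1) atTop atTop :=
        tendsto_atTop_add_const_right _ _ tendsto_natCast_atTop_atTop
      refine (h1.comp h2).congr fun k => ?_
      simp
    have hl2 : Tendsto (fun k : ℕ => (Real.log A + K * Real.log E) / (k : ℝ)) atTop (𝓝 0) :=
      tendsto_const_div_atTop_nhds_zero_nat _
    have hl3 := hl2.add (hl1.const_mul (K : ℝ))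
    simp only [mul_zero, add_zero] at hl3
    refine squeeze_zero_norm (fun k => ?_) hl3
    rw [norm_div, Real.norm_eq_abs, Real.norm_of_nonneg (Nat.cast_nonneg (α := ℝ) k)]
    have := div_le_div_of_nonneg_right (hcmp k) (Nat.cast_nonneg (α := ℝ) k)
    refine this.trans (le_of_eq ?_)
    ring
  refine ⟨-hsub.lim, ?_⟩
  have hfin := hdiff.sub hlim
  rw [zero_sub] at hfin
  refine hfin.congr fun k => ?_
  rw [← hzm k]
  ring
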